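/- The presented group on three generators x₁, x₂, x₃ with relators x₁^2, x₁*u*x₃*u⁻¹ where u = x₃⁻¹*x₁⁻¹*x₃⁻¹, and x₂*v*x₃*v⁻¹ where v = x₁⁻¹*x₂⁻¹*x₃⁻¹*x₂, is isomorphic to the presented group on three generators x₁, x₂, x₃ with relators x₁^2, x₂^2, x₃^2, (x₁*x₂)^2*((x₂*x₃)^3)⁻¹ and (x₁*x₃)^3. (This is the fundamental group computation for τ_{R(D₂(12a₁₂₂₅))} in Remark 4.21(3); in particular this group coincides with the one computed for τ_{R(D(12a₉₉₀))}.) -/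

import Mathlib

/-- The generator `x₁` of the free group on three generators. -/
def x1 : FreeGroup (Fin 3) := FreeGroup.of 0

/-- The generator `x₂` of the free group on three generators. -/
def x2 : FreeGroup (Fin 3) := FreeGroup.of 1

/-- The generator `x₃` of the free group on three generators. -/
def x3 : FreeGroup (Fin 3) := FreeGroup.of 2

/-- The relators of the Coxeter-like presentation
`⟨x₁, x₂, x₃ ∣ x₁² = x₂² = x₃² = 1, (x₁x₂)² = (x₂x₃)³, (x₁x₃)³ = 1⟩`. -/
def targetRels : Set (FreeGroup (Fin 3)) :=
  {x1 ^ 2, x2 ^ 2, x3 ^ 2, (x1 * x2) ^ 2 * ((x2 * x3) ^ 3)⁻¹, (x1 * x3) ^ 3}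

/-- The word `u = x₃⁻¹x₁⁻¹x₃⁻¹`. -/
def u : FreeGroup (Fin 3) := x3⁻¹ * x1⁻¹ * x3⁻¹

/-- The word `v = x₁⁻¹x₂⁻¹x₃⁻¹x₂`. -/
def v : FreeGroup (Fin 3) := x1⁻¹ * x2⁻¹ * x3⁻¹ * x2

/-- The τ-presentation relators of `π₁(τ_{R(D₂(12a₁₂₂₅))})`. -/
def rels15 : Set (FreeGroup (Fin 3)) :=
  {x1 ^ 2, x1 * u * x3 * u⁻¹, x2 * v * x3 * v⁻¹}

/-- In any group, the relators of `rels15` and of `targetRels` impose the same conditions on a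
triple of elements. -/
theorem rels15_iff_targetRels {G : Type*} [Group G] (a b c : G) :
    (a ^ 2 = 1 ∧ a * (c⁻¹ * a⁻¹ * c⁻¹) * c * (c⁻¹ * a⁻¹ * c⁻¹)⁻¹ = 1 ∧
      b * (a⁻¹ * b⁻¹ * c⁻¹ * b) * c * (a⁻¹ * b⁻¹ * c⁻¹ * b)⁻¹ = 1) ↔
    (a ^ 2 = 1 ∧ b ^ 2 = 1 ∧ c ^ 2 = 1 ∧ (a * b) ^ 2 * ((b * c) ^ 3)⁻¹ = 1 ∧
      (a * c) ^ 3 = 1) := by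
  have inv_of_sq {x : G} (h : x ^ 2 = 1) : x⁻¹ = x := inv_eq_of_mul_eq_one_left (by rwa [← sq])
  have sq_of_conj {x y w : G} (hx : x ^ 2 = 1) (h : x * w * y * w⁻¹ = 1) : y ^ 2 = 1 := by
    have : y = w⁻¹ * x⁻¹ * w⁻¹⁻¹ := by
      have := congrArg (fun z => w⁻¹ * x⁻¹ * z * w) h
      simpa [mul_assoc] using this
    rw [this, conj_pow, inv_pow, hx]; simp
  have sq_of_conj' {x y w : G} (hy : y ^ 2 = 1) (h : x * w * y * w⁻¹ = 1) : x ^ 2 = 1 := by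
    have : x = w * y⁻¹ * w⁻¹ := by
      rw [mul_assoc, mul_assoc, ← mul_assoc w] at h
      rw [eq_inv_of_mul_eq_one_left h]; group
    rw [this, conj_pow, inv_pow, hy]; simp
  have braid (ha : a ^ 2 = 1) (hc : c ^ 2 = 1) :
      a * (c⁻¹ * a⁻¹ * c⁻¹) * c * (c⁻¹ * a⁻¹ * c⁻¹)⁻¹ = (a * c) ^ 3 := by
    simp only [mul_inv_rev, inv_of_sq ha, inv_of_sq hc, pow_succ, pow_zero, one_mul,
      mul_assoc]
    rw [← mul_assoc c c, ← sq, hc, one_mul]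
  have twist (ha : a ^ 2 = 1) (hb : b ^ 2 = 1) (hc : c ^ 2 = 1) :
      b * (a⁻¹ * b⁻¹ * c⁻¹ * b) * c * (a⁻¹ * b⁻¹ * c⁻¹ * b)⁻¹ =
        a⁻¹ * ((a * b) ^ 2 * ((b * c) ^ 3)⁻¹) * a⁻¹⁻¹ := by
    simp only [mul_inv_rev, inv_of_sq ha, inv_of_sq hb, inv_of_sq hc, pow_succ, pow_zero,
      one_mul, mul_assoc]
    rw [← mul_assoc a a, ← sq, ha, one_mul]
  constructor
  · rintro ⟨ha, hac, hbc⟩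
    have hc := sq_of_conj ha hac
    have hb := sq_of_conj' hc hbc
    rw [braid ha hc] at hac
    rw [twist ha hb hc, conj_eq_one_iff] at hbc
    exact ⟨ha, hb, hc, hbc, hac⟩
  · rintro ⟨ha, hb, hc, hbc, hac⟩
    exact ⟨ha, by rw [braid ha hc, hac], by rw [twist ha hb hc, conj_eq_one_iff, hbc]⟩

/-- The two sets of relators have the same normal closure. -/
theorem normalClosure_rels15 :
    Subgroup.normalClosure rels15 =
      Subgroup.normalClosure targetRels := by
  have key (N : Subgroup (FreeGroup (Fin 3))) [N.Normal] :
      rels15 ⊆ ↑N ↔ targetRels ⊆ ↑N := by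
    have h := rels15_iff_targetRels (x1 : FreeGroup (Fin 3) ⧸ N) x2 x3
    simp only [← QuotientGroup.mk_mul, ← QuotientGroup.mk_inv, ← QuotientGroup.mk_pow,
      QuotientGroup.eq_one_iff] at h
    simpa only [rels15, targetRels, u, v, Set.insert_subset_iff, Set.singleton_subset_iff,
      SetLike.mem_coe] using h
  apply le_antisymm
  · exact Subgroup.normalClosure_le_normal ((key _).2 Subgroup.subset_normalClosure)
  · exact Subgroup.normalClosure_le_normal ((key _).1 Subgroup.subset_normalClosure)

/-- The fundamental group of the Price twist `τ_{R(D₂(12a₁₂₂₅))}` is isomorphic to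
`⟨x₁, x₂, x₃ ∣ x₁² = x₂² = x₃² = 1, (x₁x₂)² = (x₂x₃)³, (x₁x₃)³ = 1⟩`. -/
theorem stmt_15 : Nonempty (PresentedGroup rels15 ≃* PresentedGroup targetRels) :=
  ⟨QuotientGroup.quotientMulEquivOfEq normalClosure_rels15⟩
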